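/- The reciprocal of the stationary probability of state s satisfies 1/π_s = 1/π^0_s + 1/π^q_s − 1 = 1/π^0_s + (1/π^1_s − 1) + r1·(1/π^2_{s+n1} − 1). (Equation (4) of Proposition 2.) -/

import Mathlib

open Finset

/-- Departure rate of the two-stage reneging birth-death chain. -/
noncomputable def depRate (s n1 : ℕ) (μ θ1 θ2 : ℝ) (k : ℕ) : ℝ :=
  if k ≤ s then (k : ℝ) * μ
  else if k ≤ s + n1 then (s : ℝ) * μ + ((k : ℝ) - (s : ℝ)) * θ1
  else (s : ℝ) * μ + (n1 : ℝ) * θ1 + ((k : ℝ) - (s : ℝ) - (n1 : ℝ)) * θ2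

/-- Stationary probability of state `k` in the subchain with state set `A`. -/
noncomputable def subProb (π : ℕ → ℝ) (A : Finset ℕ) (k : ℕ) : ℝ :=
  π k / ∑ k' ∈ A, π k'

theorem sum_Icc_split_overlap (f : ℕ → ℝ) (a b c : ℕ) (hab : a ≤ b) (hbc : b ≤ c) :
    ∑ k ∈ Finset.Icc a c, f k = ∑ k ∈ Finset.Icc a b, f k + ∑ k ∈ Finset.Icc b c, f k - f b := by
  induction c, hbc using Nat.le_induction with
  | base => simp
  | succ c hc ih =>
    rw [Finset.sum_Icc_succ_top (by omega), Finset.sum_Icc_succ_top (by omega), ih]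
    ring

theorem stmt_3 (lam μ θ1 θ2 : ℝ) (hlam : 0 < lam) (hμ : 0 < μ)
    (hθ1 : 0 < θ1) (hθ2 : 0 < θ2) (s n1 n2 : ℕ) (hs : 1 ≤ s) (π : ℕ → ℝ)
    (hpos : ∀ k ∈ Finset.Icc 0 (s + n1 + n2), 0 < π k)
    (hbal : ∀ k, 1 ≤ k → k ≤ s + n1 + n2 →
      π k * depRate s n1 μ θ1 θ2 k = π (k - 1) * lam)
    (hsum : ∑ k ∈ Finset.Icc 0 (s + n1 + n2), π k = 1) :
    1 / π s = 1 / (subProb π (Finset.Icc 0 s) s) + 1 / (subProb π (Finset.Icc s (s + n1 + n2)) s) - 1 ∧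
    1 / π s = 1 / (subProb π (Finset.Icc 0 s) s) + (1 / (subProb π (Finset.Icc s (s + n1)) s) - 1) + (subProb π (Finset.Icc s (s + n1)) (s + n1) / (subProb π (Finset.Icc s (s + n1)) s)) * (1 / (subProb π (Finset.Icc (s + n1) (s + n1 + n2)) (s + n1)) - 1) := by
  have h1 := sum_Icc_split_overlap π 0 s (s + n1 + n2) (by omega) (by omega)
  have h2 := sum_Icc_split_overlap π s (s + n1) (s + n1 + n2) (by omega) (by omega)
  have ps : 0 < π s := hpos s (by simp; omega)
  have pn : 0 < π (s + n1) := hpos _ (by simp)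
  have hA : 0 < ∑ k ∈ Finset.Icc s (s + n1), π k := by
    apply Finset.sum_pos
    · intro k hk
      apply hpos
      simp only [Finset.mem_Icc] at hk ⊢
      omega
    · exact ⟨s, by simp⟩
  rw [hsum] at h1
  unfold subProb
  generalize ∑ k ∈ Finset.Icc s (s + n1), π k = A at *
  generalize ∑ k ∈ Finset.Icc 0 s, π k = B at *
  generalize ∑ k ∈ Finset.Icc (s + n1) (s + n1 + n2), π k = C at *
  generalize ∑ k ∈ Finset.Icc s (s + n1 + n2), π k = D at *
  constructor
  · simp only [one_div_div]
    field_simp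
    linarith
  · simp only [one_div_div]
    field_simp
    linarith
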